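/- Let K be a field of characteristic not equal to 3, R = K[x,y,z], and let I = (f,g,h) be a 3-generated homogeneous ideal with minimal generators f,g,h of the same degree d, defining the radical ideal of a finite set of distinct points p_1,...,p_n ∈ P^2(K). Let (P_1,P_2,P_3), (Q_1,Q_2,Q_3) be generators of the syzygy module of (f,g,h). Then I^(3) ⊆ I^2 if and only if there exist w_1,...,w_12 ∈ R such that f = P_1w_1 + P_2w_2 + P_3w_3 − Q_1w_7 − Q_2w_8 − Q_3w_9, g = P_1w_2 + P_2w_4 + P_3w_5 − Q_1w_8 − Q_2w_10 − Q_3w_11, and h = P_1w_3 + P_2w_5 + P_3w_6 − Q_1w_9 − Q_2w_11 − Q_3w_12 (i.e., if and only if (f,g,h)^T ∈ Image(Y^T)). -/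

import Mathlib

open MvPolynomial

noncomputable section

/-- The ideal of `K[x₀,…]` generated by the homogeneous polynomials vanishing at
(a representative vector of) a point of projective space. -/
def pointIdeal {K : Type*} [Field K] {n : ℕ} (v : Fin n → K) :
    Ideal (MvPolynomial (Fin n) K) :=
  Ideal.span {f | (∃ d, f.IsHomogeneous d) ∧ eval v f = 0}

/-- `I` is the ideal of a finite nonempty set of distinct (reduced) points of
projective space, given by nonzero, pairwise non-proportional representative
vectors `p 0, …, p n`. -/
def DefinesReducedPoints {K : Type*} [Field K] {N : ℕ}
    (I : Ideal (MvPolynomial (Fin (N + 1)) K)) : Prop :=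
  ∃ (n : ℕ) (p : Fin (n + 1) → (Fin (N + 1) → K)),
    (∀ i, p i ≠ 0) ∧ (∀ i j, i ≠ j → ∀ t : K, p i ≠ t • p j) ∧
    I = ⨅ i, pointIdeal (p i)

open scoped Matrix

/-- Exactness of the Koszul complex of a triple, in its two middle spots. -/
structure IsKoszulExact {R : Type*} [CommRing R] (x : Fin 3 → R) : Prop where
  cross : ∀ u : Fin 3 → R, x ⬝ᵥ u = 0 → ∃ v, u = x ⨯₃ v
  smul : ∀ u : Fin 3 → R, x ⨯₃ u = 0 → ∃ s : R, u = s • x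

theorem IsKoszulExact.of_regular {R : Type*} [CommRing R] [IsDomain R] (x : Fin 3 → R)
    (h0 : x 0 ≠ 0) (hd : ∀ a b, x 0 * a = x 1 * b → x 0 ∣ b)
    (hs : ∀ c, x 2 * c ∈ Ideal.span {x 0, x 1} → c ∈ Ideal.span {x 0, x 1}) :
    IsKoszulExact x where
  cross u hu := by
    simp only [dotProduct, Fin.sum_univ_three] at hu
    obtain ⟨p, q, hpq⟩ := Ideal.mem_span_pair.1 (hs (u 2) (Ideal.mem_span_pair.2
      ⟨-u 0, -u 1, by linear_combination -hu⟩))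
    obtain ⟨r, hr⟩ := hd (u 0 + x 2 * p) (-(u 1 + x 2 * q)) (by linear_combination hu + x 2 * hpq)
    have h : u 0 + x 2 * p = x 1 * r := mul_left_cancel₀ h0 (by
      linear_combination hu + x 2 * hpq + x 1 * hr)
    refine ⟨![-q, p, r], ?_⟩
    ext i
    fin_cases i <;> simp [cross_apply]
    · linear_combination h
    · linear_combination -hr
    · linear_combination -hpq
  smul u hu := by
    have e0 := congrFun hu 0
    have e1 := congrFun hu 1
    have e2 := congrFun hu 2
    simp [cross_apply] at e0 e1 e2
    obtain ⟨s, hs⟩ := hd (u 1) (u 0) (by linear_combination e2)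
    refine ⟨s, ?_⟩
    ext i
    fin_cases i <;> simp
    · linear_combination hs
    · exact mul_left_cancel₀ h0 (by linear_combination e2 + x 1 * hs)
    · exact mul_left_cancel₀ h0 (by linear_combination -e1 + x 2 * hs)

theorem X_pow_dvd_of_mul_eq {K : Type*} [Field K] {N : ℕ} {i j : Fin 3} (hij : i ≠ j)
    {a b : MvPolynomial (Fin 3) K} (h : X i ^ N * a = X j ^ N * b) : X i ^ N ∣ b :=
  (X_prime (i := i)).pow_dvd_of_dvd_mul_left N
    (fun hd => hij (X_dvd_X.1 ((X_prime (i := i)).dvd_of_dvd_pow hd))) ⟨a, h.symm⟩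

theorem X_pow_mul_mem_span_pair {K : Type*} [Field K] {N : ℕ} {c : MvPolynomial (Fin 3) K}
    (h : X 2 ^ N * c ∈ Ideal.span {X 0 ^ N, X 1 ^ N}) :
    c ∈ Ideal.span {(X 0 ^ N : MvPolynomial (Fin 3) K), X 1 ^ N} := by
  have key : ({X 0 ^ N, X 1 ^ N} : Set (MvPolynomial (Fin 3) K)) =
      (fun s => monomial s 1) '' {Finsupp.single 0 N, Finsupp.single 1 N} := by
    simp [Set.image_insert_eq, X_pow_eq_monomial]
  rw [key, mem_ideal_span_monomial_image] at h ⊢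
  intro m hm
  obtain ⟨s, hs, hle⟩ := h (Finsupp.single 2 N + m) (by
    rw [mem_support_iff, X_pow_eq_monomial, coeff_monomial_mul, one_mul]
    exact mem_support_iff.1 hm)
  refine ⟨s, hs, ?_⟩
  rcases hs with rfl | rfl
  all_goals
    rw [Finsupp.single_le_iff] at hle ⊢
    simpa using hle

theorem isKoszulExact_X_pow (K : Type*) [Field K] (N : ℕ) :
    IsKoszulExact fun i : Fin 3 => (X i ^ N : MvPolynomial (Fin 3) K) :=
  .of_regular _ (pow_ne_zero _ (X_ne_zero _))
    (fun _ _ => X_pow_dvd_of_mul_eq (by decide)) fun _ => X_pow_mul_mem_span_pair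

theorem isKoszulExact_C_X_pow (K : Type*) [Field K] (N : ℕ) :
    IsKoszulExact fun i : Fin 3 =>
      (C (X i ^ N) : MvPolynomial (Fin 3) (MvPolynomial (Fin 3) K)) := by
  refine .of_regular _ (by simp) (fun a b h => ?_) fun c h => ?_
  · rw [C_dvd_iff_dvd_coeff]
    intro m
    refine X_pow_dvd_of_mul_eq (i := 0) (j := 1) (by decide) (a := coeff m a) ?_
    simpa only [coeff_C_mul] using congrArg (coeff m) h
  · have key : Ideal.span {C (X 0 ^ N), C (X 1 ^ N)} =
      Ideal.map (C : MvPolynomial (Fin 3) K →+* MvPolynomial (Fin 3) (MvPolynomial (Fin 3) K))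
        (Ideal.span {X 0 ^ N, X 1 ^ N}) := by
      rw [Ideal.map_span, Set.image_pair]
    rw [key, mem_map_C_iff] at h ⊢
    intro m
    apply X_pow_mul_mem_span_pair
    simpa only [coeff_C_mul] using h m

/-- `A` and `B` have only the trivial (Koszul) relations. -/
def IsRegularPair {S : Type*} [CommRing S] (A B : S) : Prop :=
  ∀ a b : S, A * a + B * b = 0 → ∃ c, a = B * c ∧ b = -(A * c)

theorem IsRegularPair.exists_vec {S ι : Type*} [CommRing S] {A B : S} (h : IsRegularPair A B)
    {a b : ι → S} (hab : A • a + B • b = 0) : ∃ c : ι → S, a = B • c ∧ b = -(A • c) := by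
  choose c hc using fun i => h (a i) (b i) (by simpa using congrFun hab i)
  exact ⟨c, funext fun i => (hc i).1, funext fun i => (hc i).2⟩

theorem IsRelPrime.isRegularPair {S : Type*} [CommRing S] [IsDomain S] [UniqueFactorizationMonoid S]
    {A B : S} (h : IsRelPrime A B) (hB : B ≠ 0) : IsRegularPair A B := by
  intro a b hab
  obtain ⟨c, rfl⟩ : B ∣ a := h.symm.dvd_of_dvd_mul_left ⟨-b, by linear_combination hab⟩
  exact ⟨c, rfl, mul_left_cancel₀ hB (by linear_combination hab)⟩

/-- If the relation `A, B` is regular, then the ideal `(A, B)` is saturated with respect to a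
Koszul exact triple. -/
theorem IsRegularPair.mem_of_smul_eq {S : Type*} [CommRing S] [IsDomain S] {A B : S}
    (h : IsRegularPair A B) (hB : B ≠ 0) {x : Fin 3 → S} (hx : IsKoszulExact x) (hx0 : x 0 ≠ 0)
    {G : S} {a b : Fin 3 → S} (hG : G • x = A • a + B • b) : ∃ s t, G = A * s + B * t := by
  have hc : A • (x ⨯₃ a) + B • (x ⨯₃ b) = 0 := by
    rw [← map_smul, ← map_smul, ← map_add, ← hG, map_smul, cross_self, smul_zero]
  obtain ⟨c, hca, hcb⟩ := h.exists_vec hc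
  have hxc : x ⬝ᵥ c = 0 := by
    have := congrArg (x ⬝ᵥ ·) hca
    simpa [hB] using this
  obtain ⟨e, rfl⟩ := hx.cross c hxc
  obtain ⟨s, hs⟩ := hx.smul (a - B • e) (by rw [map_sub, map_smul, hca, sub_self])
  obtain ⟨t, ht⟩ := hx.smul (b + A • e) (by rw [map_add, map_smul, hcb, neg_add_cancel])
  refine ⟨s, t, mul_right_cancel₀ hx0 ?_⟩
  have hs0 := congrFun hs 0
  have ht0 := congrFun ht 0
  have hG0 := congrFun hG 0
  simp at hs0 ht0 hG0
  linear_combination hG0 + A * hs0 + B * ht0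

section LinForm

variable {R : Type*} [CommRing R]

/-- The linear form with coefficients `P`. -/
def linForm (P : Fin 3 → R) : MvPolynomial (Fin 3) R := ∑ i, C (P i) * X i

theorem isHomogeneous_linForm (P : Fin 3 → R) : (linForm P).IsHomogeneous 1 :=
  .sum _ _ _ fun i _ => isHomogeneous_C_mul_X (P i) i

theorem eval_linForm (P F : Fin 3 → R) : eval F (linForm P) = P ⬝ᵥ F := by
  simp [linForm, dotProduct]

theorem coeff_linForm (P : Fin 3 → R) (i : Fin 3) :
    coeff (Finsupp.single i 1) (linForm P) = P i := by
  simp [linForm, coeff_sum, coeff_C_mul, coeff_X, Finsupp.single_left_inj]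

theorem exists_eq_linForm {c : MvPolynomial (Fin 3) R} (hc : c.IsHomogeneous 1) :
    ∃ P, c = linForm P := by
  rw [← mem_homogeneousSubmodule, homogeneousSubmodule_one_eq_span_X] at hc
  obtain ⟨P, hP⟩ := (Submodule.mem_span_range_iff_exists_fun R).1 hc
  exact ⟨P, by simp [linForm, ← hP, smul_eq_C_mul]⟩

theorem homogeneousComponent_linForm_mul (P : Fin 3 → R) (a : MvPolynomial (Fin 3) R) (k : ℕ) :
    homogeneousComponent (k + 1) (linForm P * a) = linForm P * homogeneousComponent k a := by
  simp only [linForm, Finset.sum_mul, map_sum, mul_assoc, homogeneousComponent_C_mul]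
  refine Finset.sum_congr rfl fun i _ => congrArg _ ?_
  let _ := gradedAlgebra (R := R) (σ := Fin 3)
  have := DirectSum.coe_decompose_mul_of_left_mem_of_le
    (homogeneousSubmodule (Fin 3) R) (b := a) (n := k + 1) (i := 1) (isHomogeneous_X R i)
    (Nat.le_add_left 1 k)
  rw [← decomposition.decompose'_apply, ← decomposition.decompose'_apply]
  exact this

theorem exists_isHomogeneous_of_eq_linForm {P Q : Fin 3 → R} {k : ℕ}
    {G a b : MvPolynomial (Fin 3) R} (hG : G.IsHomogeneous (k + 1))
    (h : G = linForm P * a + linForm Q * b) :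
    ∃ a b : MvPolynomial (Fin 3) R, a.IsHomogeneous k ∧ b.IsHomogeneous k ∧
      G = linForm P * a + linForm Q * b :=
  ⟨_, _, homogeneousComponent_isHomogeneous k a, homogeneousComponent_isHomogeneous k b, by
    rw [← homogeneousComponent_linForm_mul, ← homogeneousComponent_linForm_mul, ← map_add, ← h,
      homogeneousComponent_eq_self hG]⟩

theorem IsRegularPair.exists_isHomogeneous {P Q : Fin 3 → R}
    (h : IsRegularPair (linForm P) (linForm Q)) {k : ℕ} {a b : MvPolynomial (Fin 3) R}
    (ha : a.IsHomogeneous (k + 1)) (hb : b.IsHomogeneous (k + 1))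
    (hab : linForm P * a + linForm Q * b = 0) :
    ∃ c : MvPolynomial (Fin 3) R, c.IsHomogeneous k ∧ a = linForm Q * c ∧ b = -(linForm P * c) := by
  obtain ⟨c, hca, hcb⟩ := h a b hab
  refine ⟨_, homogeneousComponent_isHomogeneous k c, ?_, ?_⟩
  · rw [← homogeneousComponent_linForm_mul, ← hca, homogeneousComponent_eq_self ha]
  · rw [← homogeneousComponent_linForm_mul, ← map_neg, ← hcb, homogeneousComponent_eq_self hb]

theorem isRelPrime_linForm [IsDomain R] {P Q : Fin 3 → R}
    (hJ : ∀ r, (∀ i, r ∣ P i) → (∀ i, r ∣ Q i) → IsUnit r)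
    (hind : ∀ (D : Fin 3 → R) (α β : R), P = α • D → Q ≠ β • D) :
    IsRelPrime (linForm P) (linForm Q) := by
  have key : ∀ (V : Fin 3 → R) (D E : MvPolynomial (Fin 3) R), linForm V = D * E →
      D.totalDegree ≠ 0 → ∃ α : R, V = α • fun i => coeff (Finsupp.single i 1) D := by
    intro V D E h hD
    rcases eq_or_ne E 0 with rfl | hE
    · refine ⟨0, funext fun i => ?_⟩
      rw [← coeff_linForm V i, h]
      simp
    · have hdeg := (isHomogeneous_linForm V).totalDegree_le
      rw [h, totalDegree_mul_of_isDomain (by rintro rfl; simp at hD) hE] at hdeg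
      have hE0 : E.totalDegree = 0 := by omega
      rw [totalDegree_eq_zero_iff_eq_C] at hE0
      refine ⟨coeff 0 E, funext fun i => ?_⟩
      rw [← coeff_linForm V i, h, hE0, mul_comm, coeff_C_mul]
      simp
  rintro D ⟨E, hE⟩ ⟨E', hE'⟩
  by_cases hD : D.totalDegree = 0
  · rw [totalDegree_eq_zero_iff_eq_C] at hD
    rw [hD]
    refine (hJ _ (fun i => ?_) fun i => ?_).map C
    · rw [← coeff_linForm P i, hE, hD, coeff_C_mul]
      simp
    · rw [← coeff_linForm Q i, hE', hD, coeff_C_mul]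
      simp
  · obtain ⟨α, hα⟩ := key P D E hE hD
    obtain ⟨β, hβ⟩ := key Q D E' hE' hD
    exact absurd hβ (hind _ _ _ hα)

end LinForm

theorem exists_forall_pow_mem {R ι : Type*} [CommRing R] [Finite ι] {I : Ideal R} {x : ι → R}
    (h : ∀ i, x i ∈ I.radical) : ∃ N, ∀ i, x i ^ N ∈ I := by
  cases nonempty_fintype ι
  choose n hn using h
  exact ⟨∑ i, n i, fun i => I.pow_mem_of_pow_mem (hn i)
    (Finset.single_le_sum (fun _ _ => Nat.zero_le _) (Finset.mem_univ i))⟩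

theorem MvPolynomial.IsHomogeneous.eval₂_const_mul {R T ι : Type*} [CommSemiring R] [CommSemiring T]
    [Fintype ι] {G : MvPolynomial ι R} {k : ℕ} (hG : G.IsHomogeneous k) (φ : R →+* T) (c : T)
    (y : ι → T) : MvPolynomial.eval₂ φ (fun i => c * y i) G = c ^ k * MvPolynomial.eval₂ φ y G := by
  rw [MvPolynomial.eval₂_eq', MvPolynomial.eval₂_eq', Finset.mul_sum]
  refine Finset.sum_congr rfl fun d hd => ?_
  have hk : ∑ i, d i = k := by
    rw [← Finsupp.degree_eq_sum]
    by_contra hne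
    exact mem_support_iff.1 hd (hG.coeff_eq_zero hne)
  rw [← hk, ← Finset.prod_pow_eq_pow_sum, mul_left_comm, ← Finset.prod_mul_distrib]
  simp only [mul_pow]

theorem UniqueFactorizationMonoid.dvd_of_forall_dvd_pow_mul {S ι : Type*} [CommRing S] [IsDomain S]
    [UniqueFactorizationMonoid S] {F : ι → S} (hF : ∀ p, (∀ i, p ∣ F i) → IsUnit p) {k : ℕ}
    {b c : S} (h : ∀ i, b ∣ F i ^ k * c) : b ∣ c := by
  induction b using UniqueFactorizationMonoid.induction_on_prime generalizing c with
  | h₁ =>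
    obtain ⟨i, hi⟩ : ∃ i, F i ≠ 0 := by
      by_contra! h0
      exact not_isUnit_zero (hF 0 fun i => by rw [h0 i])
    have := zero_dvd_iff.1 (h i)
    rw [zero_dvd_iff]
    exact (mul_eq_zero.1 this).resolve_left (pow_ne_zero k hi)
  | h₂ b hb => exact hb.dvd
  | h₃ b p hb hp ih =>
    obtain ⟨i, hi⟩ : ∃ i, ¬ p ∣ F i := by
      by_contra! h0
      exact hp.not_isUnit (hF p h0)
    obtain ⟨c, rfl⟩ : p ∣ c := (hp.dvd_or_dvd ((dvd_mul_right p b).trans (h i))).resolve_left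
      fun hd => hi (hp.dvd_of_dvd_pow hd)
    refine mul_dvd_mul_left p (ih fun j => ?_)
    have := h j
    rwa [mul_left_comm, mul_dvd_mul_iff_left hp.ne_zero] at this

section LinearType

variable {R : Type*} [CommRing R] {F P Q : Fin 3 → R}

theorem linForm_sub (v w : Fin 3 → R) : linForm (v - w) = linForm v - linForm w := by
  simp [linForm, sub_mul]

theorem linForm_single (i : Fin 3) (r : R) : linForm (Pi.single i r) = C r * X i := by
  rw [linForm, Finset.sum_eq_single i (fun j _ hj => by simp [hj]) (by simp), Pi.single_eq_same]

theorem linForm_mem_span {v : Fin 3 → R} (hv : v ∈ Submodule.span R {P, Q}) :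
    linForm v ∈ Ideal.span {linForm P, linForm Q} := by
  obtain ⟨a, b, rfl⟩ := Submodule.mem_span_pair.1 hv
  refine Ideal.mem_span_pair.2 ⟨C a, C b, ?_⟩
  simp only [linForm, Fin.sum_univ_three, Pi.add_apply, Pi.smul_apply, smul_eq_mul, map_add,
    map_mul]
  ring

theorem C_pow_mul_mem_span (hsyz : ∀ v : Fin 3 → R, v ⬝ᵥ F = 0 → v ∈ Submodule.span R {P, Q})
    {k : ℕ} {G : MvPolynomial (Fin 3) R} (hG : G.IsHomogeneous k) (h0 : eval F G = 0)
    (i : Fin 3) : C (F i) ^ k * G ∈ Ideal.span {linForm P, linForm Q} := by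
  set q := Ideal.Quotient.mk (Ideal.span {linForm P, linForm Q})
  have hq : ∀ j, q (C (F i)) * q (X j) = q (X i) * q (C (F j)) := by
    intro j
    have : linForm (Pi.single j (F i) - Pi.single i (F j)) ∈
        Ideal.span {linForm P, linForm Q} := linForm_mem_span (hsyz _ (by
      simp [sub_dotProduct, mul_comm]))
    rw [← map_mul, ← map_mul, Ideal.Quotient.eq]
    convert this using 1
    rw [linForm_sub, linForm_single, linForm_single, mul_comm (X i)]
  rw [← Ideal.Quotient.eq_zero_iff_mem]
  change q _ = 0
  have h1 := hG.eval₂_const_mul (q.comp C) (q (C (F i))) (fun j => q (X j))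
  have h2 := hG.eval₂_const_mul (q.comp C) (q (X i)) (fun j => q (C (F j)))
  have h3 : eval₂ (q.comp C) (fun j => q (X j)) G = q G := by
    conv_rhs => rw [← eval₂_eta G, eval₂_comp_left]
    rfl
  have h4 : eval₂ (q.comp C) (fun j => q (C (F j))) G = q (C (eval F G)) := by
    exact (eval₂_comp (q.comp C) F G).symm
  rw [map_mul, map_pow, ← h3, ← h1]
  simp only [hq]
  rw [h2, h4, h0, map_zero, map_zero, mul_zero]

theorem C_coeff_pow_mul_mem_span [IsDomain R] [UniqueFactorizationMonoid R]
    (hsyz : ∀ v : Fin 3 → R, v ⬝ᵥ F = 0 → v ∈ Submodule.span R {P, Q})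
    (hF : ∀ r, (∀ i, r ∣ F i) → IsUnit r)
    {k : ℕ} {G : MvPolynomial (Fin 3) R} (hG : G.IsHomogeneous k) (h0 : eval F G = 0)
    (j : Fin 3) : C (P j) ^ k * G ∈ Ideal.span {linForm P, linForm Q} := by
  set A := linForm P
  set B := linForm Q
  let σ : MvPolynomial (Fin 3) R →ₐ[R] MvPolynomial (Fin 3) R :=
    aeval fun i => C (P j) * X i - if i = j then A else 0
  have hσ : ∀ V, σ (linForm V) = C (P j) * linForm V - C (V j) * A := by
    intro V
    simp only [linForm, map_sum, map_mul, algHom_C, algebraMap_eq, σ, aeval_X, mul_sub, mul_ite,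
      mul_zero, Finset.sum_sub_distrib, Finset.sum_ite_eq', Finset.mem_univ, if_true,
      Finset.mul_sum, mul_left_comm]
  have hσA : σ A = 0 := by rw [hσ, sub_self]
  have hFC : ∀ p : MvPolynomial (Fin 3) R, (∀ i, p ∣ C (F i)) → IsUnit p := by
    intro p hp
    obtain ⟨i, hi⟩ : ∃ i, F i ≠ 0 := by
      by_contra! h0
      exact not_isUnit_zero (hF 0 fun i => by rw [h0 i])
    obtain ⟨e, he⟩ := hp i
    have hne : p * e ≠ 0 := he ▸ (C_ne_zero.2 hi)
    have hdeg := congrArg totalDegree he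
    rw [totalDegree_C, totalDegree_mul_of_isDomain (left_ne_zero_of_mul hne)
      (right_ne_zero_of_mul hne)] at hdeg
    have hp0 : p.totalDegree = 0 := by omega
    rw [totalDegree_eq_zero_iff_eq_C] at hp0
    rw [hp0]
    refine (hF _ fun i => ?_).map C
    have := hp i
    rw [hp0, C_dvd_iff_dvd_coeff] at this
    simpa using this 0
  have hdvd : σ B ∣ σ G := by
    refine UniqueFactorizationMonoid.dvd_of_forall_dvd_pow_mul hFC (k := k) fun i => ?_
    obtain ⟨a, b, hab⟩ := Ideal.mem_span_pair.1 (C_pow_mul_mem_span hsyz hG h0 i)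
    have := congrArg σ hab
    rw [map_add, map_mul, map_mul, map_mul, map_pow, hσA, mul_zero, zero_add, algHom_C,
      algebraMap_eq] at this
    exact ⟨σ b, by rw [← this, mul_comm]⟩
  set q := Ideal.Quotient.mk (Ideal.span {A, B})
  have hqA : q A = 0 := Ideal.Quotient.eq_zero_iff_mem.2 (Ideal.subset_span (by simp))
  have hqB : q B = 0 := Ideal.Quotient.eq_zero_iff_mem.2 (Ideal.subset_span (by simp))
  have hqG : q (σ G) = q (C (P j)) ^ k * q G := by
    have h1 := hG.eval₂_const_mul (q.comp C) (q (C (P j))) (fun i => q (X i))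
    have h2 := eval₂_comp_left q C X G
    rw [eval₂_eta] at h2
    change _ = q (C (P j)) ^ k * eval₂ (q.comp C) (q ∘ X) G at h1
    rw [h2, ← h1, aeval_def, eval₂_comp_left]
    change eval₂ (q.comp C) _ G = _
    congr 1
    funext i
    simp only [Function.comp_apply]
    split_ifs <;> simp [hqA]
  rw [← Ideal.Quotient.eq_zero_iff_mem]
  change q _ = 0
  obtain ⟨e, he⟩ := hdvd
  rw [map_mul, map_pow, ← hqG, he, hσ, map_mul, map_sub, map_mul, map_mul, hqA, hqB]
  simp

end LinearType

section

variable {K : Type*} [Field K] {F P Q : Fin 3 → MvPolynomial (Fin 3) K}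

/-- The kernel of the evaluation of forms at `F` is generated by linear syzygies. -/
theorem exists_isHomogeneous_of_eval_eq_zero
    (hsyz : ∀ v, v ⬝ᵥ F = 0 → v ∈ Submodule.span (MvPolynomial (Fin 3) K) {P, Q})
    (hF : ∀ r, (∀ i, r ∣ F i) → IsUnit r)
    (hrad : ∀ i, X i ∈ (Ideal.span (Set.range P ∪ Set.range Q)).radical)
    (hPQ : IsRegularPair (linForm P) (linForm Q)) (hQ : linForm Q ≠ 0)
    {k : ℕ} {G : MvPolynomial (Fin 3) (MvPolynomial (Fin 3) K)} (hG : G.IsHomogeneous (k + 1))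
    (h0 : eval F G = 0) :
    ∃ a b : MvPolynomial (Fin 3) (MvPolynomial (Fin 3) K), a.IsHomogeneous k ∧
      b.IsHomogeneous k ∧ G = linForm P * a + linForm Q * b := by
  let 𝔞 : Ideal (MvPolynomial (Fin 3) K) :=
    ((Ideal.span {linForm P, linForm Q}).colon {G}).comap C
  have h𝔞 : ∀ r, r ∈ 𝔞 ↔ C r * G ∈ Ideal.span {linForm P, linForm Q} := fun r => by
    rw [Ideal.mem_comap, Submodule.mem_colon_singleton, smul_eq_mul]
  have hle : Ideal.span (Set.range P ∪ Set.range Q) ≤ 𝔞.radical := by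
    rw [Ideal.span_le]
    rintro _ (⟨j, rfl⟩ | ⟨j, rfl⟩)
    · refine ⟨k + 1, (h𝔞 _).2 ?_⟩
      rw [map_pow]
      exact C_coeff_pow_mul_mem_span hsyz hF hG h0 j
    · refine ⟨k + 1, (h𝔞 _).2 ?_⟩
      rw [map_pow, Set.pair_comm]
      refine C_coeff_pow_mul_mem_span (fun v hv => ?_) hF hG h0 j
      rw [Set.pair_comm]
      exact hsyz v hv
  obtain ⟨N, hN⟩ := exists_forall_pow_mem (I := 𝔞) fun i =>
    (Ideal.radical_idem 𝔞 ▸ Ideal.radical_mono hle) (hrad i)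
  choose a b hab using fun i => Ideal.mem_span_pair.1 ((h𝔞 _).1 (hN i))
  obtain ⟨s, t, hst⟩ := hPQ.mem_of_smul_eq hQ (isKoszulExact_C_X_pow K N) (by simp)
    (G := G) (a := a) (b := b) (by
      funext i
      have := hab i
      simp only [Pi.smul_apply, Pi.add_apply, smul_eq_mul]
      linear_combination -this)
  exact exists_isHomogeneous_of_eq_linForm hG hst

end

section Points

variable {K : Type*} [Field K]

/-- The linear forms `X a - (v a / v k) X k`, which cut out the point `v` when `v k ≠ 0`. -/
def pointForm (v : Fin 3 → K) (k a : Fin 3) : MvPolynomial (Fin 3) K :=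
  X a - C (v a / v k) * X k

theorem pointForm_self {v : Fin 3 → K} {k : Fin 3} (hk : v k ≠ 0) : pointForm v k k = 0 := by
  simp [pointForm, hk]

theorem mem_pointIdeal_of_isHomogeneous {v : Fin 3 → K} {f : MvPolynomial (Fin 3) K} {d : ℕ}
    (hf : f.IsHomogeneous d) (h : eval v f = 0) : f ∈ pointIdeal v :=
  Ideal.subset_span ⟨⟨d, hf⟩, h⟩

theorem pointForm_mem_pointIdeal {v : Fin 3 → K} {k : Fin 3} (hk : v k ≠ 0) (a : Fin 3) :
    pointForm v k a ∈ pointIdeal v :=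
  mem_pointIdeal_of_isHomogeneous (d := 1)
    ((isHomogeneous_X K a).sub (isHomogeneous_C_mul_X _ k)) (by simp [pointForm, hk])

/-- Substituting `v a / v k * X k` for `X a` kills a form that vanishes at `v`. -/
theorem eval₂_eq_zero_of_eval_eq_zero {T : Type*} [CommRing T] (φ : K →+* T) (c : T)
    {v : Fin 3 → K} (k : Fin 3) {f : MvPolynomial (Fin 3) K} {d : ℕ}
    (hf : f.IsHomogeneous d) (h : eval v f = 0) : eval₂ φ (fun a => φ (v a / v k) * c) f = 0 := by
  have h1 := hf.eval₂_const_mul φ (c * φ (v k)⁻¹) fun a => φ (v a)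
  have h2 : φ (eval v f) = eval₂ φ (fun a => φ (v a)) f := eval₂_comp φ v f
  rw [← h2, h, map_zero, mul_zero] at h1
  rw [← h1]
  congr 1
  funext a
  rw [div_eq_mul_inv, map_mul]
  ring

theorem pointIdeal_le_span_pointForm (v : Fin 3 → K) (k : Fin 3) :
    pointIdeal v ≤ Ideal.span (Set.range (pointForm v k)) := by
  rw [pointIdeal, Ideal.span_le]
  rintro f ⟨⟨d, hf⟩, h⟩
  set q := Ideal.Quotient.mk (Ideal.span (Set.range (pointForm v k)))
  have h1 := eval₂_comp_left q C X f
  rw [eval₂_eta] at h1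
  have hX : q ∘ X = fun a => q.comp C (v a / v k) * q (X k) := by
    funext a
    simp only [Function.comp_apply, RingHom.comp_apply, ← map_mul]
    exact Ideal.Quotient.eq.2 (Ideal.subset_span ⟨a, rfl⟩)
  rw [hX, eval₂_eq_zero_of_eval_eq_zero _ _ k hf h] at h1
  exact Ideal.Quotient.eq_zero_iff_mem.1 h1

theorem X_mem_of_pointIdeal_le {v w : Fin 3 → K} (hvw : ∀ t : K, v ≠ t • w)
    {q : Ideal (MvPolynomial (Fin 3) K)} (hv : pointIdeal v ≤ q) (hw : pointIdeal w ≤ q)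
    (k : Fin 3) : X k ∈ q := by
  obtain ⟨φ, hφ, hle⟩ := Submodule.exists_le_ker_of_notMem (p := Submodule.span K {w}) (v := v)
    fun h => by
      obtain ⟨t, ht⟩ := Submodule.mem_span_singleton.1 h
      exact hvw t ht.symm
  have hφw : φ w = 0 := hle (Submodule.mem_span_singleton_self w)
  let ℓ := linForm fun i => φ (Pi.single i 1)
  have hℓ : ∀ u, eval u ℓ = φ u := fun u => by
    rw [eval_linForm, LinearMap.pi_apply_eq_sum_univ φ u, dotProduct]
    refine Finset.sum_congr rfl fun i _ => ?_
    rw [smul_eq_mul, mul_comm]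
    congr 2
    ext j
    simp [Pi.single_apply, eq_comm]
  have h1 : ℓ ∈ q := hw (mem_pointIdeal_of_isHomogeneous (isHomogeneous_linForm _)
    (by rw [hℓ, hφw]))
  have h2 : X k - C (v k / φ v) * ℓ ∈ q := hv (mem_pointIdeal_of_isHomogeneous (d := 1)
    ((isHomogeneous_X K k).sub ((isHomogeneous_linForm _).C_mul _))
    (by simp [hℓ, hφ]))
  have := q.add_mem h2 (q.mul_mem_left (C (v k / φ v)) h1)
  simpa using this

theorem X_mem_radical {ι : Type*} [Fintype ι] [DecidableEq ι] [Nonempty ι] {p : ι → Fin 3 → K}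
    (hp : ∀ i j, i ≠ j → ∀ t : K, p i ≠ t • p j) {𝔞 : Ideal (MvPolynomial (Fin 3) K)}
    (h𝔞 : ∀ i, ∀ s ∈ (Finset.univ.erase i).inf fun j => pointIdeal (p j), s ∈ 𝔞.radical)
    (k : Fin 3) : X k ∈ 𝔞.radical := by
  rw [Ideal.radical_eq_sInf, Submodule.mem_sInf]
  rintro q ⟨hq, hqp⟩
  have key : ∀ i, ∃ j ∈ Finset.univ.erase i, pointIdeal (p j) ≤ q := fun i =>
    (Ideal.IsPrime.inf_le' hqp).1 fun s hs => (hqp.radical_le_iff.2 hq) (h𝔞 i s hs)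
  obtain ⟨j, -, hj⟩ := key (Classical.arbitrary ι)
  obtain ⟨l, hl, hl'⟩ := key j
  exact X_mem_of_pointIdeal_le (hp _ _ (Finset.ne_of_mem_erase hl)) hl' hj k

theorem mul_mem_iInf_pointIdeal {ι : Type*} [Fintype ι] [DecidableEq ι] {p : ι → Fin 3 → K}
    {i : ι} {s t : MvPolynomial (Fin 3) K}
    (hs : s ∈ (Finset.univ.erase i).inf fun j => pointIdeal (p j)) (ht : t ∈ pointIdeal (p i)) :
    s * t ∈ ⨅ j, pointIdeal (p j) := by
  rw [Submodule.mem_finsetInf] at hs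
  rw [Submodule.mem_iInf]
  intro j
  rcases eq_or_ne j i with rfl | hj
  · exact Ideal.mul_mem_left _ _ ht
  · exact Ideal.mul_mem_right _ _ (hs j (by simp [hj]))

theorem exists_X_pow_mul_mem_pow {ι : Type*} [Fintype ι] [DecidableEq ι] [Nonempty ι]
    {p : ι → Fin 3 → K} (hp : ∀ i j, i ≠ j → ∀ t : K, p i ≠ t • p j) {n : ℕ}
    {F : MvPolynomial (Fin 3) K} (hF : F ∈ ⨅ i, pointIdeal (p i) ^ n) :
    ∃ N, ∀ k, X k ^ N * F ∈ (⨅ i, pointIdeal (p i)) ^ n := by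
  obtain ⟨N, hN⟩ := exists_forall_pow_mem
    (X_mem_radical hp (𝔞 := ((⨅ i, pointIdeal (p i)) ^ n).colon {F}) fun i s hs => ⟨n, by
      rw [Submodule.mem_colon_singleton, smul_eq_mul]
      have hle : Ideal.span {s} * pointIdeal (p i) ≤ ⨅ i, pointIdeal (p i) := by
        rw [Ideal.span_singleton_mul_le_iff]
        exact fun t ht => mul_mem_iInf_pointIdeal hs ht
      refine Ideal.pow_right_mono hle n ?_
      rw [mul_pow]
      exact Ideal.mul_mem_mul (Ideal.pow_mem_pow (Ideal.mem_span_singleton_self s) n)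
        ((Submodule.mem_iInf _).1 hF i)⟩)
  exact ⟨N, fun k => by simpa [Submodule.mem_colon_singleton] using hN k⟩

/-- Powers of the ideal of a point are saturated with respect to a coordinate that does not vanish
at this point. -/
theorem mem_pointIdeal_pow_of_X_pow_mul_mem {v : Fin 3 → K} {k : Fin 3} (hk : v k ≠ 0) {n N : ℕ}
    {F : MvPolynomial (Fin 3) K} (h : X k ^ N * F ∈ pointIdeal v ^ n) : F ∈ pointIdeal v ^ n := by
  let θ : MvPolynomial (Fin 3) K →ₐ[K] Polynomial (MvPolynomial (Fin 3) K) :=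
    aeval fun a => Polynomial.C (C (v a / v k) * X k) +
      Polynomial.X * Polynomial.C (pointForm v k a)
  have hθX : θ (X k) = Polynomial.C (X k) := by
    simp [θ, pointForm_self hk, hk]
  have hθ1 : ∀ f, (θ f).eval 1 = f := by
    intro f
    induction f using MvPolynomial.induction_on with
    | C a => simp [algHom_C, Polynomial.algebraMap_apply]
    | add f g hf hg => rw [map_add, Polynomial.eval_add, hf, hg]
    | mul_X f a hf =>
      rw [map_mul, Polynomial.eval_mul, hf]
      simp [θ, pointForm]
  have hθmem : ∀ f, θ f ∈ reesAlgebra (pointIdeal v) := by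
    intro f
    induction f using MvPolynomial.induction_on with
    | C a =>
      rw [algHom_C, IsScalarTower.algebraMap_apply K (MvPolynomial (Fin 3) K)]
      exact Subalgebra.algebraMap_mem _ _
    | add f g hf hg => rw [map_add]; exact add_mem hf hg
    | mul_X f a hf =>
      rw [map_mul]
      refine mul_mem hf ?_
      simp only [θ, aeval_X]
      refine add_mem (Subalgebra.algebraMap_mem _ (C (v a / v k) * X k)) ?_
      rw [mul_comm, ← pow_one Polynomial.X, Polynomial.C_mul_X_pow_eq_monomial]
      exact reesAlgebra.monomial_mem.2 (by simpa using pointForm_mem_pointIdeal hk a)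
  have hdvd : ∀ f ∈ pointIdeal v, Polynomial.X ∣ θ f := by
    have hle : pointIdeal v ≤ (Ideal.span {Polynomial.X}).comap θ.toRingHom := by
      rw [pointIdeal, Ideal.span_le]
      rintro f ⟨⟨d, hf⟩, h0⟩
      rw [SetLike.mem_coe, Ideal.mem_comap, Ideal.mem_span_singleton, Polynomial.X_dvd_iff,
        Polynomial.coeff_zero_eq_eval_zero]
      have h1 := eval₂_comp_left ((Polynomial.evalRingHom 0).comp θ.toRingHom) C X f
      rw [eval₂_eta] at h1
      change Polynomial.eval 0 (θ f) = _ at h1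
      change Polynomial.eval 0 (θ f) = 0
      refine h1.trans (Eq.trans ?_ (eval₂_eq_zero_of_eval_eq_zero C (X k) k hf h0))
      congr 1
      · ext a; simp [algHom_C, Polynomial.algebraMap_apply]
      · funext a; simp [θ]
    exact fun f hf => Ideal.mem_span_singleton.1 (hle hf)
  have hpow : Polynomial.X ^ n ∣ θ (X k ^ N * F) := by
    have hle : pointIdeal v ^ n ≤ (Ideal.span {Polynomial.X ^ n}).comap θ.toRingHom := by
      rw [← Ideal.span_singleton_pow]
      refine le_trans ?_ (Ideal.le_comap_pow _ n)
      exact Ideal.pow_right_mono (fun f hf =>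
        Ideal.mem_comap.2 (Ideal.mem_span_singleton.2 (hdvd f hf))) n
    exact Ideal.mem_span_singleton.1 (hle h)
  rw [map_mul, map_pow, hθX, ← map_pow, Polynomial.X_pow_dvd_iff] at hpow
  rw [← hθ1 F, Polynomial.eval_eq_sum, Polynomial.sum]
  refine Submodule.sum_mem _ fun j hj => ?_
  rw [one_pow, mul_one]
  rcases lt_or_ge j n with hjn | hjn
  · have := hpow j hjn
    rw [Polynomial.coeff_C_mul, mul_eq_zero] at this
    rw [this.resolve_left (pow_ne_zero _ (X_ne_zero _))]
    exact zero_mem _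
  · exact Ideal.pow_le_pow_right hjn (hθmem F j)

theorem isUnit_of_pointIdeal_le_span {v : Fin 3 → K} (hv : v ≠ 0) {r : MvPolynomial (Fin 3) K}
    (h : pointIdeal v ≤ Ideal.span {r}) : IsUnit r := by
  obtain ⟨k, hk⟩ := Function.ne_iff.1 hv
  have hk : v k ≠ 0 := hk
  obtain ⟨a, b, hak, hbk, hab⟩ : ∃ a b : Fin 3, a ≠ k ∧ b ≠ k ∧ a ≠ b :=
    (by decide : ∀ k : Fin 3, ∃ a b : Fin 3, a ≠ k ∧ b ≠ k ∧ a ≠ b) k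
  have hcoeff : ∀ a b, a ≠ k → b ≠ k → coeff (Finsupp.single b 1) (pointForm v k a) =
      if a = b then 1 else 0 := by
    intro a b ha hb
    simp [pointForm, coeff_X, coeff_C_mul, Finsupp.single_left_inj, hb.symm]
  have hform : ∀ a, a ≠ k → pointForm v k a ≠ 0 := by
    intro a ha h0
    have := hcoeff a a ha ha
    simp [h0] at this
  obtain ⟨s, hs⟩ := Ideal.mem_span_singleton.1 (h (pointForm_mem_pointIdeal hk a))
  obtain ⟨t, ht⟩ := Ideal.mem_span_singleton.1 (h (pointForm_mem_pointIdeal hk b))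
  have hr : r ≠ 0 := left_ne_zero_of_mul (hs ▸ hform a hak)
  have hs0 : s ≠ 0 := right_ne_zero_of_mul (hs ▸ hform a hak)
  have ht0 : t ≠ 0 := right_ne_zero_of_mul (ht ▸ hform b hbk)
  have hdeg : ∀ a, (pointForm v k a).totalDegree ≤ 1 := fun a =>
    ((isHomogeneous_X K a).sub (isHomogeneous_C_mul_X _ k)).totalDegree_le
  have h1 := hdeg a
  have h2 := hdeg b
  rw [hs, totalDegree_mul_of_isDomain hr hs0] at h1
  rw [ht, totalDegree_mul_of_isDomain hr ht0] at h2
  by_cases hr0 : r.totalDegree = 0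
  · rw [totalDegree_eq_zero_iff_eq_C] at hr0
    rw [hr0] at hr ⊢
    exact (isUnit_iff_ne_zero.2 (C_ne_zero.1 hr)).map C
  · exfalso
    have hs1 : s.totalDegree = 0 := by omega
    have ht1 : t.totalDegree = 0 := by omega
    rw [totalDegree_eq_zero_iff_eq_C] at hs1 ht1
    have heq : C (coeff 0 t) * pointForm v k a = C (coeff 0 s) * pointForm v k b := by
      rw [← hs1, ← ht1, hs, ht]; ring
    have := congrArg (coeff (Finsupp.single a 1)) heq
    rw [coeff_C_mul, coeff_C_mul, hcoeff a a hak hak, hcoeff b a hbk hak, if_pos rfl,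
      if_neg hab.symm, mul_one, mul_zero] at this
    rw [this, map_zero] at ht1
    exact ht0 ht1

end Points

/-- If `F` and `c` are related by matrices up to a factor `s` and `c` has a zero entry, then
`s ^ 3` is in every ideal containing the entries of the syzygies of `F`. -/
theorem pow_three_mem_of_syzygies {R : Type*} [CommRing R] {F c : Fin 3 → R} {J : Ideal R}
    (hJ : ∀ v : Fin 3 → R, v ⬝ᵥ F = 0 → ∀ j, v j ∈ J) {s : R} {k : Fin 3} (hk : c k = 0)
    (hF : ∀ i, F i ∈ Ideal.span (Set.range c))
    (hc : ∀ a, s * c a ∈ Ideal.span (Set.range F)) : s ^ 3 ∈ J := by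
  choose M hM using fun i => (Ideal.mem_span_range_iff_exists_fun).1 (hF i)
  choose L₀ hL₀ using fun a => (Ideal.mem_span_range_iff_exists_fun).1 (hc a)
  let L : Matrix (Fin 3) (Fin 3) R := fun a => if a = k then 0 else L₀ a
  have hL : ∀ a, L a ⬝ᵥ F = s * c a := by
    intro a
    by_cases h : a = k
    · simp [L, h, hk]
    · simpa [L, h, dotProduct] using hL₀ a
  have hdet : L.det = 0 := Matrix.det_eq_zero_of_row_eq_zero k fun j => by simp [L]
  let T : Matrix (Fin 3) (Fin 3) R := s • (1 : Matrix (Fin 3) (Fin 3) R) - Matrix.of M * L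
  have hT : ∀ i, T i ⬝ᵥ F = 0 := by
    have h1 : T *ᵥ F = 0 := by
      have h2 : L *ᵥ F = s • c := funext hL
      have h3 : Matrix.of M *ᵥ c = F := funext hM
      rw [Matrix.sub_mulVec, Matrix.smul_mulVec, Matrix.one_mulVec, ← Matrix.mulVec_mulVec, h2,
        Matrix.mulVec_smul, h3, sub_self]
    exact congrFun h1
  have hq : (Ideal.Quotient.mk J).mapMatrix (s • (1 : Matrix (Fin 3) (Fin 3) R)) =
      (Ideal.Quotient.mk J).mapMatrix (Matrix.of M * L) := by
    rw [← sub_eq_zero, ← map_sub]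
    ext i j
    exact Ideal.Quotient.eq_zero_iff_mem.2 (hJ _ (hT i) j)
  have := congrArg Matrix.det hq
  rw [← RingHom.map_det, ← RingHom.map_det, Matrix.det_mul, hdet, mul_zero, map_zero,
    Ideal.Quotient.eq_zero_iff_mem, Matrix.det_smul, Matrix.det_one, mul_one] at this
  simpa using this

section Functional

variable {R : Type*} [CommRing R]

theorem exists_functional_of_isSymm {W : Matrix (Fin 3) (Fin 3) R} (hW : W.IsSymm) :
    ∃ φ : MvPolynomial (Fin 3) R →ₗ[R] R, ∀ i j, φ (X i * X j) = W i j := by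
  refine ⟨(basisMonomials (Fin 3) R).constr R fun m : Fin 3 →₀ ℕ =>
    if m 0 = 2 then W 0 0 else if m 1 = 2 then W 1 1 else if m 2 = 2 then W 2 2 else
    if m 2 = 0 then W 0 1 else if m 1 = 0 then W 0 2 else W 1 2, fun i j => ?_⟩
  have h : (X i * X j : MvPolynomial (Fin 3) R) =
      basisMonomials (Fin 3) R (Finsupp.single i 1 + Finsupp.single j 1) := by
    simp [X, monomial_mul]
  rw [h, Module.Basis.constr_basis]
  have h01 := hW.apply 0 1
  have h02 := hW.apply 0 2
  have h12 := hW.apply 1 2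
  fin_cases i <;> fin_cases j <;> simp [h01, h02, h12]

theorem map_X_mul_linForm (φ : MvPolynomial (Fin 3) R →ₗ[R] R) (P : Fin 3 → R) (i : Fin 3) :
    φ (X i * linForm P) = ∑ j, P j * φ (X i * X j) := by
  rw [linForm, Finset.mul_sum, map_sum]
  refine Finset.sum_congr rfl fun j _ => ?_
  rw [mul_left_comm, ← smul_eq_C_mul, map_smul, smul_eq_mul]

theorem map_linForm_mul (φ : MvPolynomial (Fin 3) R →ₗ[R] R) (c : Fin 3 → R)
    (A : MvPolynomial (Fin 3) R) : φ (linForm c * A) = c ⬝ᵥ fun i => φ (X i * A) := by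
  rw [linForm, Finset.sum_mul, map_sum]
  refine Finset.sum_congr rfl fun j _ => ?_
  rw [mul_assoc, ← smul_eq_C_mul, map_smul, smul_eq_mul]

/-- The column space of the matrix `Yᵀ`, written with functionals on quadratic forms. -/
def imageYT (P Q : Fin 3 → R) : Submodule R (Fin 3 → R) where
  carrier := {u | ∃ φ ψ : MvPolynomial (Fin 3) R →ₗ[R] R,
    ∀ i, u i = φ (X i * linForm P) - ψ (X i * linForm Q)}
  zero_mem' := ⟨0, 0, by simp⟩
  add_mem' := by
    rintro u v ⟨φ, ψ, h⟩ ⟨φ', ψ', h'⟩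
    exact ⟨φ + φ', ψ + ψ', fun i => by simp [h, h']; ring⟩
  smul_mem' := by
    rintro r u ⟨φ, ψ, h⟩
    exact ⟨r • φ, r • ψ, fun i => by simp [h]; ring⟩

theorem mem_imageYT_iff {P Q u : Fin 3 → R} : u ∈ imageYT P Q ↔ ∃ w : Fin 12 → R,
    u 0 = P 0 * w 0 + P 1 * w 1 + P 2 * w 2 - Q 0 * w 6 - Q 1 * w 7 - Q 2 * w 8 ∧
    u 1 = P 0 * w 1 + P 1 * w 3 + P 2 * w 4 - Q 0 * w 7 - Q 1 * w 9 - Q 2 * w 10 ∧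
    u 2 = P 0 * w 2 + P 1 * w 4 + P 2 * w 5 - Q 0 * w 8 - Q 1 * w 10 - Q 2 * w 11 := by
  constructor
  · rintro ⟨φ, ψ, h⟩
    refine ⟨![φ (X 0 * X 0), φ (X 0 * X 1), φ (X 0 * X 2), φ (X 1 * X 1), φ (X 1 * X 2),
      φ (X 2 * X 2), ψ (X 0 * X 0), ψ (X 0 * X 1), ψ (X 0 * X 2), ψ (X 1 * X 1), ψ (X 1 * X 2),
      ψ (X 2 * X 2)], ?_, ?_, ?_⟩ <;>
    rw [h, map_X_mul_linForm, map_X_mul_linForm, Fin.sum_univ_three, Fin.sum_univ_three] <;>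
    simp [mul_comm (X 1 : MvPolynomial (Fin 3) R) (X 0),
      mul_comm (X 2 : MvPolynomial (Fin 3) R) (X 0),
      mul_comm (X 2 : MvPolynomial (Fin 3) R) (X 1)] <;> ring
  · rintro ⟨w, h0, h1, h2⟩
    obtain ⟨φ, hφ⟩ := exists_functional_of_isSymm (W := !![w 0, w 1, w 2; w 1, w 3, w 4;
      w 2, w 4, w 5]) (by ext i j; fin_cases i <;> fin_cases j <;> rfl)
    obtain ⟨ψ, hψ⟩ := exists_functional_of_isSymm (W := !![w 6, w 7, w 8; w 7, w 9, w 10;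
      w 8, w 10, w 11]) (by ext i j; fin_cases i <;> fin_cases j <;> rfl)
    refine ⟨φ, ψ, fun i => ?_⟩
    simp only [map_X_mul_linForm, Fin.sum_univ_three, hφ, hψ]
    fin_cases i <;> simp [h0, h1, h2] <;> ring

theorem imageYT_comm_le (P Q : Fin 3 → R) : imageYT P Q ≤ imageYT Q P := by
  rintro u ⟨φ, ψ, h⟩
  exact ⟨-ψ, -φ, fun i => by rw [h]; simp; ring⟩

theorem sq_smul_mem_imageYT (P Q : Fin 3 → R) (k : Fin 3) (u : Fin 3 → R) :
    P k ^ 2 • u ∈ imageYT P Q := by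
  let e : Fin 3 → R := Pi.single k 1
  let W : Matrix (Fin 3) (Fin 3) R :=
    P k • (Matrix.vecMulVec e u + Matrix.vecMulVec u e) - (u ⬝ᵥ P) • Matrix.vecMulVec e e
  have hW : W.IsSymm := by
    ext i j
    simp [W, Matrix.vecMulVec_apply]
    ring
  obtain ⟨φ, hφ⟩ := exists_functional_of_isSymm hW
  refine ⟨φ, 0, fun i => ?_⟩
  have h1 : ∑ j, P j * W i j = (W *ᵥ P) i :=
    Finset.sum_congr rfl fun j _ => mul_comm _ _
  have h2 : e ⬝ᵥ P = P k := by simp [e]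
  simp only [map_X_mul_linForm, hφ, h1, W, Matrix.sub_mulVec, Matrix.smul_mulVec,
    Matrix.add_mulVec, Matrix.vecMulVec_mulVec, h2]
  simp
  ring

theorem exists_X_pow_smul_mem_imageYT {K : Type*} [Field K]
    {P Q : Fin 3 → MvPolynomial (Fin 3) K}
    (hrad : ∀ i, X i ∈ (Ideal.span (Set.range P ∪ Set.range Q)).radical) :
    ∃ N, ∀ i (u : Fin 3 → MvPolynomial (Fin 3) K),
      (X i : MvPolynomial (Fin 3) K) ^ N • u ∈ imageYT P Q := by
  let 𝔞 : Ideal (MvPolynomial (Fin 3) K) := (imageYT P Q).colon Set.univ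
  have hle : Ideal.span (Set.range P ∪ Set.range Q) ≤ 𝔞.radical := by
    rw [Ideal.span_le]
    rintro _ (⟨j, rfl⟩ | ⟨j, rfl⟩)
    · exact ⟨2, Submodule.mem_colon.2 fun u _ => sq_smul_mem_imageYT P Q j u⟩
    · exact ⟨2, Submodule.mem_colon.2 fun u _ =>
        imageYT_comm_le Q P (sq_smul_mem_imageYT Q P j u)⟩
  obtain ⟨N, hN⟩ := exists_forall_pow_mem (I := 𝔞) fun i =>
    (Ideal.radical_idem 𝔞 ▸ Ideal.radical_mono hle) (hrad i)
  exact ⟨N, fun i u => Submodule.mem_colon.1 (hN i) u trivial⟩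

end Functional

section Duality

variable {K : Type*} [Field K]

theorem mem_span_X_pow_iff {N : ℕ} {r : MvPolynomial (Fin 3) K} :
    r ∈ Ideal.span (Set.range fun i => X i ^ N) ↔
      ∀ e : Fin 3 →₀ ℕ, (∀ i, e i < N) → coeff e r = 0 := by
  have h : (Set.range fun i : Fin 3 => (X i ^ N : MvPolynomial (Fin 3) K)) =
      (fun s => monomial s 1) '' Set.range fun i => Finsupp.single i N := by
    rw [← Set.range_comp]
    simp [X_pow_eq_monomial, Function.comp_def]
  rw [h, mem_ideal_span_monomial_image]
  refine forall_congr' fun e => ?_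
  simp only [Set.exists_range_iff, Finsupp.single_le_iff, mem_support_iff]
  rw [← not_imp_not, not_not]
  simp

/-- The quotient of the polynomial ring by powers of the variables is self-injective: a vector
outside a submodule containing these powers is detected by a functional. -/
theorem exists_dotProduct_notMem {N : ℕ}
    {M : Submodule (MvPolynomial (Fin 3) K) (Fin 3 → MvPolynomial (Fin 3) K)}
    (hM : ∀ i (u : Fin 3 → MvPolynomial (Fin 3) K),
      (X i : MvPolynomial (Fin 3) K) ^ (N + 1) • u ∈ M)
    {v : Fin 3 → MvPolynomial (Fin 3) K} (hv : v ∉ M) :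
    ∃ c : Fin 3 → MvPolynomial (Fin 3) K,
      (∀ u ∈ M, c ⬝ᵥ u ∈ Ideal.span (Set.range fun i => X i ^ (N + 1))) ∧
      c ⬝ᵥ v ∉ Ideal.span (Set.range fun i => X i ^ (N + 1)) := by
  obtain ⟨φ, hφv, hφ⟩ := Submodule.exists_le_ker_of_notMem (p := M.restrictScalars K) (v := v) hv
  let t : Fin 3 →₀ ℕ := Finsupp.equivFunOnFinite.symm fun _ => N
  have hle : ∀ e : Fin 3 →₀ ℕ, e ≤ t ↔ ∀ i, e i < N + 1 := fun e => by
    simp [Finsupp.le_def, t]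
  let c : Fin 3 → MvPolynomial (Fin 3) K := fun j =>
    ∑ e ∈ Finset.Iic t, monomial (t - e) (φ (Pi.single j (monomial e 1)))
  have hc : ∀ u, coeff t (c ⬝ᵥ u) = φ u := by
    let μ : (Fin 3 → MvPolynomial (Fin 3) K) →ₗ[K] K :=
      { toFun := fun u => coeff t (c ⬝ᵥ u)
        map_add' := fun u w => by rw [dotProduct_add, coeff_add]
        map_smul' := fun a u => by rw [dotProduct_smul, coeff_smul]; rfl }
    suffices h : μ = φ from fun u => congrArg (· u) h
    refine LinearMap.pi_ext' fun j => (basisMonomials (Fin 3) K).ext fun e => ?_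
    rw [coe_basisMonomials]
    change coeff t (c ⬝ᵥ Pi.single j (monomial e 1)) = φ (Pi.single j (monomial e 1))
    rw [dotProduct_single, coeff_mul_monomial']
    split_ifs with he
    · rw [mul_one]
      simp only [c, coeff_sum, coeff_monomial]
      rw [Finset.sum_eq_single e, if_pos rfl]
      · intro e' he' hne
        rw [if_neg fun h => hne ?_]
        rw [← tsub_tsub_cancel_of_le (Finset.mem_Iic.1 he'), h, tsub_tsub_cancel_of_le he]
      · exact fun h => absurd (Finset.mem_Iic.2 he) h
    · rw [hle] at he
      push Not at he
      obtain ⟨i, hi⟩ := he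
      have hmem := hM i (Pi.single j (monomial (e - Finsupp.single i (N + 1)) 1))
      have heq : (X i : MvPolynomial (Fin 3) K) ^ (N + 1) • (Pi.single j
          (monomial (e - Finsupp.single i (N + 1)) 1) : Fin 3 → MvPolynomial (Fin 3) K) =
          Pi.single j (monomial e 1) := by
        rw [← Pi.single_smul, smul_eq_mul, X_pow_eq_monomial, monomial_mul, one_mul,
          add_tsub_cancel_of_le (Finsupp.single_le_iff.2 hi)]
      rw [heq] at hmem
      exact (LinearMap.mem_ker.1 (hφ hmem)).symm
  refine ⟨c, fun u hu => mem_span_X_pow_iff.2 fun e he => ?_, fun h => ?_⟩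
  · have het := (hle e).2 he
    have h1 : φ ((monomial (t - e) (1 : K)) • u) = 0 :=
      LinearMap.mem_ker.1 (hφ (M.smul_mem _ hu))
    rw [← hc, dotProduct_smul, smul_eq_mul, coeff_monomial_mul', if_pos tsub_le_self,
      tsub_tsub_cancel_of_le het, one_mul] at h1
    exact h1
  · exact hφv ((hc v).symm.trans (mem_span_X_pow_iff.1 h t fun i => by simp [t]))

end Duality

section Polar

variable {R : Type*} [CommRing R]

/-- The derivation `∑ i, F i * ∂ᵢ` of a polynomial ring. -/
def polar (F : Fin 3 → R) : Derivation R (MvPolynomial (Fin 3) R) (MvPolynomial (Fin 3) R) :=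
  mkDerivation R fun i => C (F i)

theorem polar_apply (F : Fin 3 → R) (G : MvPolynomial (Fin 3) R) :
    polar F G = ∑ i, C (F i) * pderiv i G := by
  have h : polar F = F 0 • pderiv 0 + F 1 • pderiv 1 + F 2 • pderiv 2 := derivation_ext fun i => by
    fin_cases i <;> simp [polar, smul_eq_C_mul]
  simp [h, Fin.sum_univ_three, smul_eq_C_mul]

theorem polar_linForm (F c : Fin 3 → R) : polar F (linForm c) = C (c ⬝ᵥ F) := by
  simp [linForm, polar, dotProduct]

theorem MvPolynomial.IsHomogeneous.polar {F : Fin 3 → R} {G : MvPolynomial (Fin 3) R} {k : ℕ}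
    (hG : G.IsHomogeneous (k + 1)) : (polar F G).IsHomogeneous k := by
  rw [polar_apply]
  exact .sum _ _ _ fun i _ => hG.pderiv.C_mul _

theorem eval_polar {F : Fin 3 → R} {G : MvPolynomial (Fin 3) R} {k : ℕ}
    (hG : G.IsHomogeneous k) : eval F (polar F G) = k * eval F G := by
  have h := congrArg (eval F) hG.sum_X_mul_pderiv
  simpa [polar_apply] using h

theorem polar_linForm_mul {F c : Fin 3 → R} (hc : c ⬝ᵥ F = 0) (G : MvPolynomial (Fin 3) R) :
    polar F (linForm c * G) = linForm c * polar F G := by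
  rw [Derivation.leibniz, polar_linForm, hc]
  simp

variable {x : Fin 3 → R}

theorem LinearMap.map_C_mul_mvPolynomial {M : Type*} [AddCommGroup M] [Module R M]
    (L : MvPolynomial (Fin 3) R →ₗ[R] M) (r : R) (G : MvPolynomial (Fin 3) R) :
    L (C r * G) = r • L G := by
  rw [← smul_eq_C_mul, map_smul]

theorem map_C_dotProduct {M : Type*} [AddCommGroup M] [Module R M]
    (L : MvPolynomial (Fin 3) R →ₗ[R] M) (a : Fin 3 → MvPolynomial (Fin 3) R) :
    L ((fun i => C (x i)) ⬝ᵥ a) = ∑ i, x i • L (a i) := by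
  simp [dotProduct, LinearMap.map_C_mul_mvPolynomial]

theorem comp_C_cross (L : MvPolynomial (Fin 3) R →ₗ[R] MvPolynomial (Fin 3) R)
    (a : Fin 3 → MvPolynomial (Fin 3) R) :
    (fun i => L (((fun i => C (x i)) ⨯₃ a) i)) = (fun i => C (x i)) ⨯₃ fun i => L (a i) := by
  ext1 i
  fin_cases i <;> simp [cross_apply, LinearMap.map_C_mul_mvPolynomial, smul_eq_C_mul]

theorem eval_C_cross (F : Fin 3 → R) (a : Fin 3 → MvPolynomial (Fin 3) R) :
    (fun i => eval F (((fun i => C (x i)) ⨯₃ a) i)) = x ⨯₃ fun i => eval F (a i) := by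
  ext1 i
  fin_cases i <;> simp [cross_apply]

theorem polar_C_cross (F : Fin 3 → R) (a : Fin 3 → MvPolynomial (Fin 3) R) :
    (fun i => polar F (((fun i => C (x i)) ⨯₃ a) i)) =
      (fun i => C (x i)) ⨯₃ fun i => polar F (a i) :=
  comp_C_cross (polar F).toLinearMap a

theorem polar_C_dotProduct (F : Fin 3 → R) (a : Fin 3 → MvPolynomial (Fin 3) R) :
    polar F ((fun i => C (x i)) ⬝ᵥ a) = (fun i => C (x i)) ⬝ᵥ fun i => polar F (a i) :=
  (map_C_dotProduct (polar F).toLinearMap a).trans (by simp [dotProduct, smul_eq_C_mul])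

theorem linForm_neg (P : Fin 3 → R) : linForm (-P) = -linForm P := by
  simp [linForm]

theorem isHomogeneous_C_cross {a : Fin 3 → MvPolynomial (Fin 3) R} {k : ℕ}
    (ha : ∀ i, (a i).IsHomogeneous k) (i : Fin 3) :
    (((fun i => C (x i)) ⨯₃ a) i).IsHomogeneous k := by
  fin_cases i <;> exact ((ha _).C_mul _).sub ((ha _).C_mul _)

theorem isHomogeneous_C_dotProduct {a : Fin 3 → MvPolynomial (Fin 3) R} {k : ℕ}
    (ha : ∀ i, (a i).IsHomogeneous k) : ((fun i => C (x i)) ⬝ᵥ a).IsHomogeneous k :=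
  .sum _ _ _ fun i _ => (ha i).C_mul _

end Polar

section Core

variable {K : Type*} [Field K]

/-- `P` and `Q` span the syzygies of a triple `F` that has no common factor, and the entries of
`P` and `Q` generate an ideal whose radical contains the variables. -/
structure IsSyzygyBasis (F P Q : Fin 3 → MvPolynomial (Fin 3) K) : Prop where
  mem_span_iff : ∀ v, v ⬝ᵥ F = 0 ↔ v ∈ Submodule.span (MvPolynomial (Fin 3) K) {P, Q}
  isUnit : ∀ r, (∀ i, r ∣ F i) → IsUnit r
  X_mem_radical : ∀ i, X i ∈ (Ideal.span (Set.range P ∪ Set.range Q)).radical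
  isRegularPair : IsRegularPair (linForm P) (linForm Q)
  linForm_ne_zero : linForm Q ≠ 0

namespace IsSyzygyBasis

variable {F P Q : Fin 3 → MvPolynomial (Fin 3) K}

theorem left_dotProduct (h : IsSyzygyBasis F P Q) : P ⬝ᵥ F = 0 :=
  (h.mem_span_iff P).2 (Submodule.subset_span (by simp))

theorem right_dotProduct (h : IsSyzygyBasis F P Q) : Q ⬝ᵥ F = 0 :=
  (h.mem_span_iff Q).2 (Submodule.subset_span (by simp))

theorem exists_of_eval_eq_zero (h : IsSyzygyBasis F P Q)
    {g : Fin 3 → MvPolynomial (Fin 3) (MvPolynomial (Fin 3) K)} {k : ℕ}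
    (hg : ∀ i, (g i).IsHomogeneous (k + 1)) (h0 : ∀ i, eval F (g i) = 0) :
    ∃ a b : Fin 3 → MvPolynomial (Fin 3) (MvPolynomial (Fin 3) K),
      (∀ i, (a i).IsHomogeneous k) ∧ (∀ i, (b i).IsHomogeneous k) ∧
      g = linForm P • a + linForm Q • b := by
  choose a b ha hb hab using fun i => exists_isHomogeneous_of_eval_eq_zero
    (fun v => (h.mem_span_iff v).1) h.isUnit h.X_mem_radical h.isRegularPair h.linForm_ne_zero
    (hg i) (h0 i)
  exact ⟨a, b, ha, hb, funext hab⟩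

theorem three_mul_mem_pow_two (h : IsSyzygyBasis F P Q) (hF : F ∈ imageYT P Q) {N : ℕ}
    {G : MvPolynomial (Fin 3) K} (hG : ∀ i, X i ^ N * G ∈ Ideal.span (Set.range F) ^ 3) :
    3 * G ∈ Ideal.span (Set.range F) ^ 2 := by
  have hx := isKoszulExact_C_X_pow K N
  set x : Fin 3 → MvPolynomial (Fin 3) (MvPolynomial (Fin 3) K) := fun i => C (X i ^ N)
  set A := linForm P
  set B := linForm Q
  choose g hg hgG using fun i => (Ideal.mem_span_pow_iff_exists_isHomogeneous F _).1 (hG i)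
  obtain ⟨a, b, ha, hb, hab⟩ := h.exists_of_eval_eq_zero (isHomogeneous_C_cross hg) fun i => by
    rw [congrFun (eval_C_cross (x := fun i => X i ^ N) F g) i]
    simp only [hgG]
    fin_cases i <;> simp [cross_apply] <;> ring
  change x ⨯₃ g = A • a + B • b at hab
  have hdot : A * (x ⬝ᵥ a) + B * (x ⬝ᵥ b) = 0 := by
    have := congrArg (x ⬝ᵥ ·) hab
    simpa using this.symm
  obtain ⟨c, hc, hca, hcb⟩ := h.isRegularPair.exists_isHomogeneous
    (isHomogeneous_C_dotProduct ha) (isHomogeneous_C_dotProduct hb) hdot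
  change x ⬝ᵥ a = B * c at hca
  change x ⬝ᵥ b = -(A * c) at hcb
  obtain ⟨c, rfl⟩ := exists_eq_linForm hc
  obtain ⟨φ, ψ, hφψ⟩ := hF
  let e : Fin 3 → MvPolynomial (Fin 3) K := fun i => -φ (b i) - ψ (a i)
  have hcF : c ⬝ᵥ F = (fun i => X i ^ N) ⬝ᵥ e := by
    have h1 : c ⬝ᵥ F = φ (linForm c * A) - ψ (linForm c * B) := by
      rw [map_linForm_mul, map_linForm_mul, ← dotProduct_sub]
      exact congrArg _ (funext hφψ)
    have h2 : linForm c * A = -(x ⬝ᵥ b) := by rw [hcb]; ring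
    have h3 : linForm c * B = x ⬝ᵥ a := by rw [hca]; ring
    rw [h1, h2, h3, map_neg, map_C_dotProduct, map_C_dotProduct]
    simp only [dotProduct, e, smul_eq_mul, ← Finset.sum_neg_distrib, ← Finset.sum_sub_distrib]
    exact Finset.sum_congr rfl fun i _ => by ring
  have hC : polar F (linForm c) = x ⬝ᵥ fun i => C (e i) := by
    rw [polar_linForm, hcF]
    simp [dotProduct, x]
  have hA : ∀ G, polar F (A * G) = A * polar F G := polar_linForm_mul h.left_dotProduct
  have hB : ∀ G, polar F (B * G) = B * polar F G := polar_linForm_mul h.right_dotProduct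
  have hpolar : ∀ a, polar F (x ⬝ᵥ a) = x ⬝ᵥ fun i => polar F (a i) :=
    polar_C_dotProduct F
  obtain ⟨u, hu⟩ := hx.cross ((fun i => polar F (a i)) - B • fun i => C (e i)) (by
    rw [dotProduct_sub, ← hpolar, hca, hB, hC, dotProduct_smul, smul_eq_mul, sub_self])
  obtain ⟨v, hv⟩ := hx.cross ((fun i => polar F (b i)) + A • fun i => C (e i)) (by
    rw [dotProduct_add, ← hpolar, hcb, map_neg, hA, hC, dotProduct_smul, smul_eq_mul,
      neg_add_cancel])
  obtain ⟨s, hs⟩ := hx.smul ((fun i => polar F (g i)) - (A • u + B • v)) (by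
    have h1 : x ⨯₃ (fun i => polar F (g i)) =
        A • (fun i => polar F (a i)) + B • fun i => polar F (b i) := by
      refine (polar_C_cross F g).symm.trans ?_
      change (fun i => polar F ((x ⨯₃ g) i)) = _
      ext1 i
      simp [hab, hA, hB]
    rw [map_sub, map_add, map_smul, map_smul, ← hu, ← hv, h1]
    ext1 i
    simp
    ring)
  have h0 := congrArg (fun G => eval F (homogeneousComponent 2 G)) (congrFun hs 0)
  simp only [Pi.sub_apply, Pi.add_apply, Pi.smul_apply, smul_eq_mul, map_sub, map_add, A, B,
    homogeneousComponent_linForm_mul, homogeneousComponent_eq_self (hg 0).polar, mul_comm s,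
    homogeneousComponent_C_mul, map_mul, eval_linForm, h.left_dotProduct, h.right_dotProduct,
    eval_polar (hg 0), hgG, eval_C, x] at h0
  refine (Ideal.mem_span_pow_iff_exists_isHomogeneous F _).2
    ⟨_, homogeneousComponent_isHomogeneous 2 s, ?_⟩
  refine mul_left_cancel₀ (pow_ne_zero N (X_ne_zero (0 : Fin 3))) (h0.symm.trans ?_)
  push_cast
  ring

theorem exists_notMem_pow_two (h : IsSyzygyBasis F P Q) (hF : F ∉ imageYT P Q) :
    ∃ (N : ℕ) (G : MvPolynomial (Fin 3) K), (∀ i, X i ^ N * G ∈ Ideal.span (Set.range F) ^ 3) ∧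
      G ∉ Ideal.span (Set.range F) ^ 2 := by
  obtain ⟨M, hM⟩ := exists_X_pow_smul_mem_imageYT h.X_mem_radical
  obtain ⟨c, hc, hcF⟩ := exists_dotProduct_notMem (N := M) (fun i u => by
    rw [pow_succ', mul_smul]
    exact Submodule.smul_mem _ _ (hM i u)) hF
  set N := M + 1
  have hx := isKoszulExact_C_X_pow K N
  set x : Fin 3 → MvPolynomial (Fin 3) (MvPolynomial (Fin 3) K) := fun i => C (X i ^ N)
  set A := linForm P
  set B := linForm Q
  have key : ∀ V : Fin 3 → MvPolynomial (Fin 3) K,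
      (∀ φ : MvPolynomial (Fin 3) (MvPolynomial (Fin 3) K) →ₗ[MvPolynomial (Fin 3) K]
        MvPolynomial (Fin 3) K, (fun i => φ (X i * linForm V)) ∈ imageYT P Q) →
      ∃ a : Fin 3 → MvPolynomial (Fin 3) (MvPolynomial (Fin 3) K), (∀ i, (a i).IsHomogeneous 2) ∧
        x ⬝ᵥ a = linForm V * linForm c := by
    intro V hV
    have hmem : linForm c * linForm V ∈
        (Ideal.span (Set.range fun i : Fin 3 => (X i ^ N : MvPolynomial (Fin 3) K))).map C :=
      mem_map_C_iff.2 fun m => by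
        have := hc _ (hV (lcoeff (MvPolynomial (Fin 3) K) m))
        rwa [← map_linForm_mul] at this
    rw [Ideal.map_span, ← Set.range_comp, Ideal.mem_span_range_iff_exists_fun] at hmem
    obtain ⟨a, ha⟩ := hmem
    refine ⟨fun i => homogeneousComponent 2 (a i),
      fun i => homogeneousComponent_isHomogeneous 2 _, ?_⟩
    rw [← homogeneousComponent_eq_self (p := linForm V * linForm c) (n := 2)
      ((isHomogeneous_linForm V).mul (isHomogeneous_linForm c)), mul_comm, ← ha, map_sum]
    exact Finset.sum_congr rfl fun i _ => by
      rw [Function.comp_apply, mul_comm (a i), homogeneousComponent_C_mul]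
  obtain ⟨a, ha, hca⟩ := key Q fun φ => ⟨0, -φ, fun i => by simp⟩
  obtain ⟨b, hb, hcb⟩ := key (-P) fun φ => ⟨-φ, 0, fun i => by
    have hneg : X i * linForm (-P) = -(X i * linForm P) := by rw [linForm_neg]; ring
    simp [hneg]⟩
  rw [linForm_neg] at hcb
  obtain ⟨g₀, hg₀⟩ := hx.cross (A • a + B • b) (by
    rw [dotProduct_add, dotProduct_smul, dotProduct_smul, hca, hcb, smul_eq_mul, smul_eq_mul]
    ring)
  let g : Fin 3 → MvPolynomial (Fin 3) (MvPolynomial (Fin 3) K) :=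
    fun i => homogeneousComponent 3 (g₀ i)
  have hg : ∀ i, (g i).IsHomogeneous 3 := fun i => homogeneousComponent_isHomogeneous 3 _
  have hxg : x ⨯₃ g = A • a + B • b := by
    refine (comp_C_cross (homogeneousComponent 3) g₀).symm.trans (funext fun i => ?_)
    change homogeneousComponent 3 ((x ⨯₃ g₀) i) = _
    rw [← hg₀]
    simp [A, B, homogeneousComponent_linForm_mul, homogeneousComponent_eq_self (ha i),
      homogeneousComponent_eq_self (hb i)]
  obtain ⟨G, hG⟩ := (isKoszulExact_X_pow K N).smul (fun i => eval F (g i)) (by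
    rw [← eval_C_cross]
    change (fun i => eval F ((x ⨯₃ g) i)) = 0
    ext1 i
    simp [hxg, A, B, eval_linForm, h.left_dotProduct, h.right_dotProduct])
  have hG : ∀ i, eval F (g i) = X i ^ N * G := fun i => by
    simpa [mul_comm] using congrFun hG i
  refine ⟨N, G, fun i => (Ideal.mem_span_pow_iff_exists_isHomogeneous F _).2 ⟨g i, hg i, hG i⟩,
    fun hmem => hcF ?_⟩
  obtain ⟨H, hH, rfl⟩ := (Ideal.mem_span_pow_iff_exists_isHomogeneous F _).1 hmem
  have hA : ∀ G, polar F (A * G) = A * polar F G := polar_linForm_mul h.left_dotProduct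
  have hB : ∀ G, polar F (B * G) = B * polar F G := polar_linForm_mul h.right_dotProduct
  obtain ⟨u, v, -, -, huv⟩ := h.exists_of_eval_eq_zero (k := 1)
    (g := fun i => polar F (g i) - C (X i ^ N) * (C 3 * H))
    (fun i => (hg i).polar.sub ((hH.C_mul _).C_mul _)) fun i => by
      simp [eval_polar (hg i), hG]
      ring
  have hcross : x ⨯₃ (fun i => polar F (g i)) = A • (x ⨯₃ u) + B • (x ⨯₃ v) := by
    have h1 : (fun i => polar F (g i)) = A • u + B • v + (C 3 * H) • x := by
      rw [← huv]
      ext1 i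
      simp [x]
      ring
    rw [h1, map_add, map_smul, cross_self, smul_zero, add_zero, map_add, map_smul, map_smul]
  have hpolar : x ⨯₃ (fun i => polar F (g i)) =
      A • (fun i => polar F (a i)) + B • fun i => polar F (b i) := by
    refine (polar_C_cross F g).symm.trans ?_
    change (fun i => polar F ((x ⨯₃ g) i)) = _
    ext1 i
    simp [hxg, hA, hB]
  obtain ⟨e, he, -⟩ := h.isRegularPair.exists_vec
    (a := (fun i => polar F (a i)) - x ⨯₃ u) (b := (fun i => polar F (b i)) - x ⨯₃ v) (by
      change A • _ + B • _ = 0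
      rw [smul_sub, smul_sub, sub_add_sub_comm, ← hpolar, hcross, sub_self])
  have hCc : C (c ⬝ᵥ F) = x ⬝ᵥ e := by
    refine mul_left_cancel₀ h.linForm_ne_zero ?_
    have h2 : x ⬝ᵥ (fun i => polar F (a i)) = B * C (c ⬝ᵥ F) := by
      rw [← polar_linForm, ← hB, ← hca, polar_C_dotProduct]
    have h3 := congrArg (x ⬝ᵥ ·) he
    simp only [dotProduct_sub, h2, dot_self_cross, sub_zero, dotProduct_smul, smul_eq_mul] at h3
    exact h3
  have h4 := congrArg constantCoeff hCc
  rw [constantCoeff_C] at h4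
  rw [h4, dotProduct, map_sum]
  refine Ideal.sum_mem _ fun i _ => ?_
  rw [map_mul, constantCoeff_C]
  exact Ideal.mul_mem_right _ _ (Ideal.subset_span ⟨i, rfl⟩)

end IsSyzygyBasis

end Core

section Points

variable {K : Type*} [Field K]

theorem isUnit_of_iInf_pointIdeal_le {ι : Type*} [Fintype ι] {p : ι → Fin 3 → K}
    (hp : ∀ i, p i ≠ 0) {r : MvPolynomial (Fin 3) K} (hr : r ≠ 0)
    (h : ⨅ i, pointIdeal (p i) ≤ Ideal.span {r}) : IsUnit r := by
  by_contra hu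
  obtain ⟨π, hπ, hπr⟩ := WfDvdMonoid.exists_irreducible_factor hu hr
  have hprime : (Ideal.span {π}).IsPrime :=
    (Ideal.span_singleton_prime hπ.ne_zero).2 hπ.prime
  obtain ⟨i, -, hi⟩ := (Ideal.IsPrime.inf_le' (s := Finset.univ)
    (f := fun i => pointIdeal (p i)) hprime).1 (by
      rw [Finset.inf_univ_eq_iInf]
      exact h.trans (Ideal.span_singleton_le_span_singleton.2 hπr))
  exact hπ.not_isUnit (isUnit_of_pointIdeal_le_span (hp i) hi)

theorem isUnit_of_forall_dvd {𝔞 : Ideal (MvPolynomial (Fin 3) K)} (h : ∀ i, X i ∈ 𝔞.radical)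
    {r : MvPolynomial (Fin 3) K} (hr : ∀ s ∈ 𝔞, r ∣ s) : IsUnit r := by
  obtain ⟨N, hN⟩ := exists_forall_pow_mem h
  have hrel : IsRelPrime (X 0 ^ N : MvPolynomial (Fin 3) K) (X 1 ^ N) := by
    refine IsRelPrime.pow ((X_prime (i := (0 : Fin 3))).irreducible.isRelPrime_iff_not_dvd.2 ?_)
    rw [X_dvd_X]
    decide
  exact hrel (hr _ (hN 0)) (hr _ (hN 1))

theorem isSyzygyBasis_of_points {ι : Type*} [Fintype ι] [Nonempty ι] {p : ι → Fin 3 → K}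
    (hp0 : ∀ i, p i ≠ 0) (hp : ∀ i j, i ≠ j → ∀ t : K, p i ≠ t • p j)
    {F P Q : Fin 3 → MvPolynomial (Fin 3) K} (hF : Ideal.span (Set.range F) = ⨅ i, pointIdeal (p i))
    (hF0 : F 0 ≠ 0) (hF2 : F 2 ≠ 0)
    (hsyz : ∀ v, v ⬝ᵥ F = 0 ↔ v ∈ Submodule.span (MvPolynomial (Fin 3) K) {P, Q}) :
    IsSyzygyBasis F P Q := by
  classical
  let J := Ideal.span (Set.range P ∪ Set.range Q)
  have hJ : ∀ v, v ⬝ᵥ F = 0 → ∀ j, v j ∈ J := by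
    intro v hv j
    obtain ⟨a, b, rfl⟩ := Submodule.mem_span_pair.1 ((hsyz v).1 hv)
    exact J.add_mem (J.mul_mem_left _ (Ideal.subset_span (.inl ⟨j, rfl⟩)))
      (J.mul_mem_left _ (Ideal.subset_span (.inr ⟨j, rfl⟩)))
  have hrad : ∀ i, X i ∈ J.radical := X_mem_radical hp fun i s hs => by
    obtain ⟨k, hk⟩ := Function.ne_iff.1 (hp0 i)
    refine ⟨3, pow_three_mem_of_syzygies hJ (pointForm_self hk) (fun j => ?_) fun a => ?_⟩
    · refine pointIdeal_le_span_pointForm (p i) k ?_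
      exact (hF.le.trans (iInf_le _ i)) (Ideal.subset_span ⟨j, rfl⟩)
    · rw [hF]
      exact mul_mem_iInf_pointIdeal hs (pointForm_mem_pointIdeal hk a)
  have hind : ∀ (D : Fin 3 → MvPolynomial (Fin 3) K) (α β : MvPolynomial (Fin 3) K),
      P = α • D → Q ≠ β • D := by
    rintro D α β rfl rfl
    have hD : ∀ v, v ⬝ᵥ F = 0 → ∃ s : MvPolynomial (Fin 3) K, v = s • D := by
      intro v hv
      obtain ⟨a, b, rfl⟩ := Submodule.mem_span_pair.1 ((hsyz v).1 hv)
      exact ⟨a * α + b * β, by rw [add_smul, mul_smul, mul_smul]⟩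
    obtain ⟨s, hs⟩ := hD ![F 2, 0, -F 0] (by simp [dotProduct, Fin.sum_univ_three]; ring)
    obtain ⟨t, ht⟩ := hD ![0, F 2, -F 1] (by simp [dotProduct, Fin.sum_univ_three]; ring)
    have hs0 := congrFun hs 0
    have hs1 := congrFun hs 1
    have ht1 := congrFun ht 1
    simp only [Matrix.cons_val, Pi.smul_apply, smul_eq_mul] at hs0 hs1 ht1
    rcases mul_eq_zero.1 hs1.symm with h | h
    · exact hF2 (by rw [hs0, h, zero_mul])
    · exact hF2 (by rw [ht1, h, mul_zero])
  have hQ : linForm Q ≠ 0 := fun h => hind P 1 0 (one_smul _ P).symm (by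
    ext1 i
    rw [← coeff_linForm Q i, h, zero_smul]
    simp)
  refine ⟨hsyz, fun r hr => isUnit_of_iInf_pointIdeal_le hp0 ?_ ?_, hrad,
    (isRelPrime_linForm (fun r hrP hrQ => isUnit_of_forall_dvd hrad fun s hs => ?_)
      hind).isRegularPair hQ, hQ⟩
  · rintro rfl
    exact hF0 (zero_dvd_iff.1 (hr 0))
  · rw [← hF, Ideal.span_le]
    rintro _ ⟨i, rfl⟩
    exact Ideal.mem_span_singleton.2 (hr i)
  · rw [← Ideal.mem_span_singleton]
    refine (Ideal.span_le.2 ?_ : J ≤ Ideal.span {r}) hs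
    rintro _ (⟨i, rfl⟩ | ⟨i, rfl⟩)
    · exact Ideal.mem_span_singleton.2 (hrP i)
    · exact Ideal.mem_span_singleton.2 (hrQ i)

theorem iInf_pointIdeal_pow_three_le_iff {ι : Type*} [Fintype ι] [Nonempty ι] {p : ι → Fin 3 → K}
    (hp0 : ∀ i, p i ≠ 0) (hp : ∀ i j, i ≠ j → ∀ t : K, p i ≠ t • p j) (h3 : (3 : K) ≠ 0)
    {F P Q : Fin 3 → MvPolynomial (Fin 3) K} (hF : Ideal.span (Set.range F) = ⨅ i, pointIdeal (p i))
    (h : IsSyzygyBasis F P Q) :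
    (⨅ i, pointIdeal (p i) ^ 3) ≤ Ideal.span (Set.range F) ^ 2 ↔ F ∈ imageYT P Q := by
  classical
  constructor
  · contrapose
    intro hFY hle
    obtain ⟨N, G, hG, hG2⟩ := h.exists_notMem_pow_two hFY
    refine hG2 (hle ((Submodule.mem_iInf _).2 fun i => ?_))
    obtain ⟨k, hk⟩ := Function.ne_iff.1 (hp0 i)
    exact mem_pointIdeal_pow_of_X_pow_mul_mem hk
      (Ideal.pow_right_mono (hF.le.trans (iInf_le _ i)) 3 (hG k))
  · intro hFY G hG
    obtain ⟨N, hN⟩ := exists_X_pow_mul_mem_pow hp hG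
    have hmem := h.three_mul_mem_pow_two hFY (G := G) fun i => hF ▸ hN i
    have hG3 : G = C (3 : K)⁻¹ * (3 * G) := by
      rw [← mul_assoc, ← map_ofNat C 3, ← map_mul, inv_mul_cancel₀ h3, map_one, one_mul]
    rw [hG3]
    exact Ideal.mul_mem_left _ _ hmem

end Points

/-- Theorem `main`: for a 3-generated ideal `I = (f,g,h)` of a
finite set of distinct points of `P²`, uniformly generated in degree `d`, over
a field of characteristic `≠ 3`, one has `I⁽³⁾ ⊆ I²` iff `(f,g,h)ᵀ` lies in the
image of `Yᵀ`, i.e. iff there exist `w₁,…,w₁₂ ∈ R` solving the three displayed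
equations. -/
theorem symbolic_cube_in_square_iff {K : Type*} [Field K]
    (hchar : ringChar K ≠ 3) (n : ℕ) (p : Fin (n + 1) → (Fin 3 → K))
    (hp0 : ∀ i, p i ≠ 0)
    (hpdist : ∀ i j, i ≠ j → ∀ t : K, p i ≠ t • p j)
    (I : Ideal (MvPolynomial (Fin 3) K))
    (f g h : MvPolynomial (Fin 3) K)
    (P Q : Fin 3 → MvPolynomial (Fin 3) K) (d : ℕ)
    (hI : I = ⨅ i, pointIdeal (p i))
    (hgen : I = Ideal.span {f, g, h})
    (hminf : f ∉ Ideal.span {g, h}) (hming : g ∉ Ideal.span {f, h})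
    (hminh : h ∉ Ideal.span {f, g})
    (hdf : f.IsHomogeneous d) (hdg : g.IsHomogeneous d)
    (hdh : h.IsHomogeneous d)
    (hsyz : ∀ v : Fin 3 → MvPolynomial (Fin 3) K,
      (v 0 * f + v 1 * g + v 2 * h = 0) ↔
        v ∈ Submodule.span (MvPolynomial (Fin 3) K) {P, Q}) :
    (⨅ i, pointIdeal (p i) ^ 3) ≤ I ^ 2 ↔
      ∃ w : Fin 12 → MvPolynomial (Fin 3) K,
        f = P 0 * w 0 + P 1 * w 1 + P 2 * w 2
              - Q 0 * w 6 - Q 1 * w 7 - Q 2 * w 8 ∧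
        g = P 0 * w 1 + P 1 * w 3 + P 2 * w 4
              - Q 0 * w 7 - Q 1 * w 9 - Q 2 * w 10 ∧
        h = P 0 * w 2 + P 1 * w 4 + P 2 * w 5
              - Q 0 * w 8 - Q 1 * w 10 - Q 2 * w 11 := by
  have h3 : (3 : K) ≠ 0 := fun h => hchar <|
    ((Nat.dvd_prime Nat.prime_three).1 ((ringChar.spec K 3).1 (by exact_mod_cast h))).resolve_left
      CharP.ringChar_ne_one
  have hrange : Set.range ![f, g, h] = {f, g, h} := by
    ext
    simp [eq_comm]
    tauto
  have hspan : Ideal.span (Set.range ![f, g, h]) = ⨅ i, pointIdeal (p i) := by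
    rw [hrange, ← hgen, hI]
  have hbasis : IsSyzygyBasis ![f, g, h] P Q := isSyzygyBasis_of_points hp0 hpdist hspan
    (by rintro rfl; exact hminf (zero_mem _)) (by rintro rfl; exact hminh (zero_mem _))
    fun v => by
      rw [← hsyz, dotProduct, Fin.sum_univ_three]
      rfl
  rw [hgen, ← hrange, iInf_pointIdeal_pow_three_le_iff hp0 hpdist h3 hspan hbasis, mem_imageYT_iff]
  rfl

end
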